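/- A sequence (X_n)_{n≥1} of random elements of D (equipped with the metric d_{J1} and its Borel σ-algebra) is tight if and only if (i) lim_{C→+∞} limsup_n P(‖X_n‖∞ ≥ C) = 0, and (ii) for every ε > 0, lim_{δ↓0} limsup_n P(ω'_δ(X_n) ≥ ε) = 0. -/

import Mathlib

open Set Filter Topology

noncomputable section

/-- The unit interval `[0,1] ⊆ ℝ`, as a type. -/
abbrev unitI : Type := ↥(Set.Icc (0:ℝ) 1)

/-- The point `0` of the unit interval. -/
def i0 : unitI := ⟨0, by norm_num⟩

/-- The point `1` of the unit interval. -/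
def i1 : unitI := ⟨1, by norm_num⟩

/-- A function `f : [0,1] → ℝ` is càdlàg if it is right-continuous at every point and
has a left limit at every point (both conditions being vacuous where the corresponding
one-sided neighbourhood filter is trivial). -/
def Cadlag (f : unitI → ℝ) : Prop :=
  (∀ t : unitI, Tendsto f (𝓝[>] t) (𝓝 (f t))) ∧
  (∀ t : unitI, ∃ L : ℝ, Tendsto f (𝓝[<] t) (𝓝 L))

/-- The Skorokhod space `D` of càdlàg functions `[0,1] → ℝ`. -/
def D : Type := {f : unitI → ℝ // Cadlag f}

/-- A time change: a strictly increasing bijection `λ : [0,1] → [0,1]`. -/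
def TimeChange (l : unitI → unitI) : Prop := StrictMono l ∧ Function.Bijective l

/-- The Skorokhod `J₁` metric
`d_{J1}(f,g) = inf_λ ( sup_t |f(λ t) - g t| + sup_t |λ t - t| )`. -/
def dJ1 (f g : D) : ℝ :=
  sInf {x : ℝ | ∃ l : unitI → unitI, TimeChange l ∧
    x = (⨆ t : unitI, |f.1 (l t) - g.1 t|) + ⨆ t : unitI, |(l t : ℝ) - (t : ℝ)|}


open MeasureTheory

/-- The càdlàg modulus of continuity `ω'_δ(f)`: the infimum, over finite partitions
`0 = t₀ < t₁ < ⋯ < t_v = 1` with `t_i - t_{i-1} > δ`, of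
`max_i sup_{s,u ∈ [t_{i-1}, t_i)} |f u - f s|`. -/
def omegaP (δ : ℝ) (f : D) : ℝ :=
  sInf {x : ℝ | ∃ (v : ℕ) (t : Fin (v + 1) → unitI),
    t 0 = i0 ∧ t (Fin.last v) = i1 ∧
    (∀ i : Fin v, δ < (t i.succ : ℝ) - (t i.castSucc : ℝ)) ∧
    x = sSup {y : ℝ | ∃ (i : Fin v) (s u : unitI),
      t i.castSucc ≤ s ∧ s < t i.succ ∧ t i.castSucc ≤ u ∧ u < t i.succ ∧
      y = |f.1 u - f.1 s|}}

/-- `D` carries the topology of the metric `d_{J1}`, generated by the open balls. -/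
instance : TopologicalSpace D :=
  TopologicalSpace.generateFrom
    {s | ∃ (f : D) (ε : ℝ), 0 < ε ∧ s = {g | dJ1 f g < ε}}

/-- `D` carries the Borel σ-algebra of the `J₁`-topology. -/
instance : MeasurableSpace D := borel D

def Prt (v : ℕ) (t : Fin (v + 1) → unitI) (δ : ℝ) : Prop :=
  t 0 = i0 ∧ t (Fin.last v) = i1 ∧
    ∀ i : Fin v, δ < (t i.succ : ℝ) - (t i.castSucc : ℝ)

def Osc (v : ℕ) (t : Fin (v + 1) → unitI) (f : unitI → ℝ) (ε : ℝ) : Prop :=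
  ∀ (i : Fin v) (s u : unitI), t i.castSucc ≤ s → s < t i.succ → t i.castSucc ≤ u →
    u < t i.succ → |f u - f s| ≤ ε

def PP (δ ε : ℝ) (f : unitI → ℝ) : Prop :=
  ∃ (v : ℕ) (t : Fin (v + 1) → unitI), Prt v t δ ∧ Osc v t f ε

lemma i0_le (s : unitI) : i0 ≤ s := s.2.1
lemma le_i1 (s : unitI) : s ≤ i1 := s.2.2
lemma i0_lt_i1 : i0 < i1 := by
  show (0:ℝ) < 1
  norm_num

def StepR (f : unitI → ℝ) (ε : ℝ) (a b : unitI) : Prop :=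
  a < b ∧ ∀ s u, a ≤ s → s < b → a ≤ u → u < b → |f u - f s| ≤ ε

lemma chain_all {f : unitI → ℝ} (hf : Cadlag f) {ε : ℝ} (hε : 0 < ε) :
    Relation.ReflTransGen (StepR f ε) i0 i1 := by
  set S : Set unitI := {s | Relation.ReflTransGen (StepR f ε) i0 s} with hS
  have h0 : i0 ∈ S := Relation.ReflTransGen.refl
  obtain ⟨m, hm⟩ : ∃ m, IsLUB S m := by
    have : Fact ((0:ℝ) ≤ 1) := ⟨zero_le_one⟩
    exact ⟨sSup S, isLUB_sSup S⟩
  have hmS : m ∈ S := by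
    obtain ⟨L, hL⟩ := hf.2 m
    by_cases hmz : m = i0
    · rw [hmz]; exact h0
    have hlt : i0 < m := lt_of_le_of_ne (i0_le m) (Ne.symm hmz)
    have h1 : {u | |f u - L| < ε / 2} ∈ 𝓝[<] m := by
      have := hL (Metric.ball_mem_nhds L (half_pos hε))
      filter_upwards [this] with u hu
      simpa [Real.dist_eq] using hu
    rw [mem_nhdsLT_iff_exists_Ioo_subset' hlt] at h1
    obtain ⟨a, ha, hsub⟩ := h1
    obtain ⟨s, hsS, hs⟩ := (lt_isLUB_iff hm).1 ha
    rcases (hm.1 hsS).eq_or_lt with h | h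
    · rw [← h]; exact hsS
    refine Relation.ReflTransGen.tail hsS ⟨h, ?_⟩
    intro x u hx hxm hu hum
    have e1 : |f x - L| < ε / 2 := hsub ⟨lt_of_lt_of_le hs hx, hxm⟩
    have e2 : |f u - L| < ε / 2 := hsub ⟨lt_of_lt_of_le hs hu, hum⟩
    rw [abs_lt] at e1 e2
    rw [abs_le]
    constructor <;> linarith
  by_cases hm1 : m = i1
  · rw [← hm1]; exact hmS
  exfalso
  have hlt : m < i1 := lt_of_le_of_ne (le_i1 m) hm1
  have h1 : {u | |f u - f m| < ε / 2} ∈ 𝓝[>] m := by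
    have := hf.1 m (Metric.ball_mem_nhds (f m) (half_pos hε))
    filter_upwards [this] with u hu
    simpa [Real.dist_eq] using hu
  rw [mem_nhdsGT_iff_exists_Ioo_subset' hlt] at h1
  obtain ⟨b, hb, hsub⟩ := h1
  have hbS : b ∈ S := by
    refine Relation.ReflTransGen.tail hmS ⟨hb, ?_⟩
    have key : ∀ x, m ≤ x → x < b → |f x - f m| < ε / 2 := by
      intro x hx hxb
      rcases hx.eq_or_lt with h | h
      · rw [← h]; simpa using half_pos hε
      · exact hsub ⟨h, hxb⟩
    intro x u hx hxm hu hum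
    have e1 := key x hx hxm
    have e2 := key u hu hum
    rw [abs_lt] at e1 e2
    rw [abs_le]
    constructor <;> linarith
  exact absurd (hm.1 hbS) (not_le.2 hb)

lemma cadlag_bdd {f : unitI → ℝ} (hf : Cadlag f) : ∃ M, ∀ s, |f s| ≤ M := by
  have hc := chain_all hf one_pos
  have : ∀ b, Relation.ReflTransGen (StepR f 1) i0 b → ∃ M, ∀ s < b, |f s| ≤ M := by
    intro b hb
    induction hb with
    | refl => exact ⟨0, fun s hs => absurd hs (not_lt.2 (i0_le s))⟩
    | @tail b c _ hbc ih =>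
      obtain ⟨M, hM⟩ := ih
      refine ⟨max M (|f b| + 1), fun s hs => ?_⟩
      rcases lt_or_ge s b with h | h
      · exact (hM s h).trans (le_max_left _ _)
      · have := hbc.2 b s le_rfl hbc.1 h hs
        refine le_trans ?_ (le_max_right _ _)
        have h2 : |f s| ≤ |f b| + |f s - f b| := by
          have := abs_add_le (f b) (f s - f b)
          simpa using this
        linarith
  obtain ⟨M, hM⟩ := this _ hc
  refine ⟨max M |f i1|, fun s => ?_⟩
  rcases (le_i1 s).eq_or_lt with h | h
  · rw [h]; exact le_max_right _ _
  · exact (hM s h).trans (le_max_left _ _)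

lemma exists_lt_all {v : ℕ} {F : Fin v → ℝ} {δ : ℝ} (h : ∀ i, δ < F i) :
    ∃ δ' > δ, ∀ i, δ' < F i := by
  rcases isEmpty_or_nonempty (Fin v) with he | hne
  · exact ⟨δ + 1, by linarith, fun i => he.elim i⟩
  · obtain ⟨j, hj⟩ := Finite.exists_min F
    exact ⟨(δ + F j) / 2, by have := h j; simp only [gt_iff_lt]; linarith,
      fun i => by have := h j; have := hj i; linarith⟩

lemma PP_of_cadlag {f : unitI → ℝ} (hf : Cadlag f) {ε : ℝ} (hε : 0 < ε) :
    ∃ δ > 0, PP δ ε f := by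
  have hc := chain_all hf hε
  have : ∀ b, Relation.ReflTransGen (StepR f ε) i0 b → ∃ (v : ℕ) (t : ℕ → unitI),
      t 0 = i0 ∧ t v = b ∧ ∀ i < v, StepR f ε (t i) (t (i + 1)) := by
    intro b hb
    induction hb with
    | refl => exact ⟨0, fun _ => i0, rfl, rfl, fun i hi => absurd hi (Nat.not_lt_zero i)⟩
    | @tail b c _ hbc ih =>
      obtain ⟨v, t, h0, hv, hs⟩ := ih
      refine ⟨v + 1, fun n => if n ≤ v then t n else c, ?_, ?_, ?_⟩
      · simpa using h0
      · simp
      · intro i hi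
        rcases (Nat.lt_succ_iff.1 hi).eq_or_lt with h | h
        · subst h; simpa [hv] using hbc
        · have h1 : i ≤ v := h.le
          have h2 : i + 1 ≤ v := h
          simpa [h1, h2] using hs i h
  obtain ⟨v, t, h0, hv, hs⟩ := this _ hc
  obtain ⟨δ, hδ, hg⟩ := exists_lt_all (v := v) (δ := 0)
    (F := fun i => (t (i.val + 1) : ℝ) - (t i.val : ℝ))
    (fun i => sub_pos.2 (hs i.val i.2).1)
  refine ⟨δ, hδ, v, fun i => t i.val, ⟨h0, hv, fun i => hg i⟩, ?_⟩
  intro i s u h1 h2 h3 h4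
  exact (hs i.val i.2).2 s u h1 h2 h3 h4

lemma Prt_loc {v : ℕ} {t : Fin (v + 1) → unitI} (h0 : t 0 = i0) (h1 : t (Fin.last v) = i1)
    {s : unitI} (hs : s < i1) : ∃ i : Fin v, t i.castSucc ≤ s ∧ s < t i.succ := by
  by_contra hcon
  push Not at hcon
  have : ∀ i : Fin (v + 1), t i ≤ s := by
    intro i
    induction i using Fin.induction with
    | zero => rw [h0]; exact i0_le s
    | succ i ih => exact hcon i ih
  have := this (Fin.last v)
  rw [h1] at this
  exact absurd this (not_le.2 hs)

lemma Prt_loc' {v : ℕ} {t : Fin (v + 1) → unitI} (h0 : t 0 = i0) (h1 : t (Fin.last v) = i1)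
    {s : unitI} (hs : i0 < s) : ∃ i : Fin v, t i.castSucc < s ∧ s ≤ t i.succ := by
  by_contra hcon
  push Not at hcon
  have : ∀ i : Fin (v + 1), t i < s := by
    intro i
    induction i using Fin.induction with
    | zero => rw [h0]; exact hs
    | succ i ih => exact hcon i ih
  have := this (Fin.last v)
  rw [h1] at this
  exact absurd this (not_lt.2 (le_i1 s))

lemma PP_mono {δ δ' ε ε' : ℝ} {f : unitI → ℝ} (h : PP δ ε f) (hδ : δ' ≤ δ) (hε : ε ≤ ε') :
    PP δ' ε' f := by
  obtain ⟨v, t, ⟨a, b, c⟩, d⟩ := h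
  exact ⟨v, t, ⟨a, b, fun i => lt_of_le_of_lt hδ (c i)⟩,
    fun i s u h1 h2 h3 h4 => (d i s u h1 h2 h3 h4).trans hε⟩

lemma PP_nonneg {δ ε : ℝ} {f : unitI → ℝ} (h : PP δ ε f) : 0 ≤ ε := by
  obtain ⟨v, t, ⟨a, b, c⟩, d⟩ := h
  obtain ⟨i, h1, h2⟩ := Prt_loc a b i0_lt_i1
  exact (abs_nonneg _).trans (d i i0 i0 h1 h2 h1 h2)

lemma omegaP_lt_iff {δ ε : ℝ} (f : D) (hδ : δ < 1) :
    omegaP δ f < ε ↔ ∃ ε' < ε, PP δ ε' f.1 := by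
  obtain ⟨M, hM⟩ := cadlag_bdd f.2
  unfold omegaP
  constructor
  · intro h
    obtain ⟨x, ⟨v, t, h0, h1, hg, rfl⟩, hx⟩ := exists_lt_of_csInf_lt
      (by
        refine ⟨_, 1, ![i0, i1], rfl, rfl, ?_, rfl⟩
        intro i
        fin_cases i
        simpa [i0, i1] using hδ) h
    refine ⟨_, hx, v, t, ⟨h0, h1, hg⟩, ?_⟩
    intro i s u a b c d
    refine le_csSup ⟨M + M, ?_⟩ ⟨i, s, u, a, b, c, d, rfl⟩
    rintro y ⟨i, s, u, -, -, -, -, rfl⟩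
    exact (abs_sub _ _).trans (add_le_add (hM u) (hM s))
  · rintro ⟨ε', hε', hP⟩
    have hn := PP_nonneg hP
    obtain ⟨v, t, ⟨h0, h1, hg⟩, ho⟩ := hP
    refine lt_of_le_of_lt ?_ hε'
    refine le_trans (csInf_le ⟨0, ?_⟩ ⟨v, t, h0, h1, hg, rfl⟩) ?_
    · rintro x ⟨v, t, -, -, -, rfl⟩
      apply Real.sSup_nonneg
      rintro y ⟨i, s, u, -, -, -, -, rfl⟩
      exact abs_nonneg _
    · apply Real.sSup_le _ hn
      rintro y ⟨i, s, u, a, b, c, d, rfl⟩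
      exact ho i s u a b c d

def WW (a b : ℝ) (f g : unitI → ℝ) : Prop :=
  ∃ l : unitI → unitI, TimeChange l ∧ (∀ t, |f (l t) - g t| ≤ a) ∧
    ∀ t, |(l t : ℝ) - (t : ℝ)| ≤ b

lemma dJ1_lt_iff {f g : D} {η : ℝ} :
    dJ1 f g < η ↔ ∃ a b, a + b < η ∧ WW a b f.1 g.1 := by
  obtain ⟨M, hM⟩ := cadlag_bdd f.2
  obtain ⟨M', hM'⟩ := cadlag_bdd g.2
  unfold dJ1
  constructor
  · intro h
    obtain ⟨x, ⟨l, hl, rfl⟩, hx⟩ := exists_lt_of_csInf_lt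
      (by exact ⟨_, id, ⟨strictMono_id, Function.bijective_id⟩, rfl⟩) h
    refine ⟨_, _, hx, l, hl, fun t => ?_, fun t => ?_⟩
    · refine le_ciSup (f := fun t => |f.1 (l t) - g.1 t|) ⟨M + M', ?_⟩ t
      rintro _ ⟨t, rfl⟩
      exact (abs_sub _ _).trans (add_le_add (hM _) (hM' _))
    · refine le_ciSup (f := fun t : unitI => |(l t : ℝ) - (t : ℝ)|) ⟨1, ?_⟩ t
      rintro _ ⟨t, rfl⟩
      have h1 := (l t).2
      have h2 := t.2
      simp only [abs_le]
      constructor <;> linarith [h1.1, h1.2, h2.1, h2.2]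
  · rintro ⟨a, b, hab, l, hl, h1, h2⟩
    refine lt_of_le_of_lt ?_ hab
    refine le_trans (csInf_le ⟨0, ?_⟩ ⟨l, hl, rfl⟩) (add_le_add ?_ ?_)
    · rintro x ⟨l, -, rfl⟩
      exact add_nonneg (Real.iSup_nonneg fun t => abs_nonneg _)
        (Real.iSup_nonneg fun t => abs_nonneg _)
    · exact Real.iSup_le h1 ((abs_nonneg _).trans (h1 i0))
    · exact Real.iSup_le h2 ((abs_nonneg _).trans (h2 i0))

lemma WW_refl (f : unitI → ℝ) : WW 0 0 f f :=
  ⟨id, ⟨strictMono_id, Function.bijective_id⟩, fun t => by simp, fun t => by simp⟩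

lemma TimeChange.inv {l : unitI → unitI} (hl : TimeChange l) :
    ∃ m, TimeChange m ∧ (∀ t, l (m t) = t) ∧ ∀ t, m (l t) = t := by
  set e := Equiv.ofBijective l hl.2
  have h1 : ∀ t, l (e.symm t) = t := fun t => e.apply_symm_apply t
  refine ⟨e.symm, ⟨?_, e.symm.bijective⟩, h1, fun t => e.symm_apply_apply t⟩
  intro a b hab
  rw [← hl.1.lt_iff_lt, h1, h1]
  exact hab

lemma WW_symm {a b : ℝ} {f g : unitI → ℝ} (h : WW a b f g) : WW a b g f := by
  obtain ⟨l, hl, h1, h2⟩ := h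
  obtain ⟨m, hm, hlm, -⟩ := hl.inv
  refine ⟨m, hm, fun t => ?_, fun t => ?_⟩
  · have := h1 (m t)
    rw [hlm, abs_sub_comm] at this
    exact this
  · have := h2 (m t)
    rw [hlm, abs_sub_comm] at this
    exact this

lemma WW_trans {a b a' b' : ℝ} {f g h : unitI → ℝ} (h1 : WW a b f g) (h2 : WW a' b' g h) :
    WW (a + a') (b + b') f h := by
  obtain ⟨l, hl, p, q⟩ := h1
  obtain ⟨m, hm, p', q'⟩ := h2
  refine ⟨l ∘ m, ⟨hl.1.comp hm.1, hl.2.comp hm.2⟩, fun t => ?_, fun t => ?_⟩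
  · exact (abs_sub_le _ (g (m t)) _).trans (add_le_add (p _) (p' _))
  · exact (abs_sub_le _ (m t : ℝ) _).trans (add_le_add (q _) (q' _))

lemma WW_bdd {a b C : ℝ} {f g : unitI → ℝ} (h : WW a b f g) (hf : ∀ t, |f t| ≤ C) (t : unitI) :
    |g t| ≤ C + a := by
  obtain ⟨l, hl, h1, h2⟩ := h
  have e1 := h1 t
  have e2 := hf (l t)
  rw [abs_le] at *
  constructor <;> linarith

lemma WW_PP {a b δ ε : ℝ} {f g : unitI → ℝ} (h : WW a b f g) (hf : PP δ ε f) :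
    PP (δ - 2 * b) (ε + 2 * a) g := by
  obtain ⟨l, hl, h1, h2⟩ := WW_symm h
  obtain ⟨v, t, ⟨p, q, r⟩, ho⟩ := hf
  obtain ⟨m, hm, hlm, hml⟩ := hl.inv
  refine ⟨v, fun i => l (t i), ⟨?_, ?_, fun i => ?_⟩, ?_⟩
  · refine le_antisymm ?_ (i0_le _)
    rw [← hlm i0]
    simp only [p]
    exact hl.1.monotone (i0_le _)
  · refine le_antisymm (le_i1 _) ?_
    rw [← hlm i1]
    simp only [q]
    exact hl.1.monotone (le_i1 _)
  · have e1 := h2 (t i.succ)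
    have e2 := h2 (t i.castSucc)
    have e3 := r i
    rw [abs_le] at e1 e2
    linarith
  · intro i s u x1 x2 x3 x4
    have e := ho i (m s) (m u) (by rwa [← hl.1.le_iff_le, hlm]) (by rwa [← hl.1.lt_iff_lt, hlm])
      (by rwa [← hl.1.le_iff_le, hlm]) (by rwa [← hl.1.lt_iff_lt, hlm])
    have e1 := h1 (m s)
    have e2 := h1 (m u)
    rw [hlm] at e1 e2
    rw [abs_le] at *
    constructor <;> linarith

lemma ball_open (f : D) {ε : ℝ} (hε : 0 < ε) : IsOpen {g : D | dJ1 f g < ε} :=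
  TopologicalSpace.isOpen_generateFrom_of_mem ⟨f, ε, hε, rfl⟩

lemma dJ1_self (f : D) {ε : ℝ} (hε : 0 < ε) : dJ1 f f < ε :=
  dJ1_lt_iff.2 ⟨0, 0, by simpa using hε, WW_refl _⟩

lemma WW_b_nonneg {a b : ℝ} {f g : unitI → ℝ} (h : WW a b f g) : 0 ≤ a ∧ 0 ≤ b := by
  obtain ⟨l, -, h1, h2⟩ := h
  exact ⟨(abs_nonneg _).trans (h1 i0), (abs_nonneg _).trans (h2 i0)⟩

lemma open_of {S : Set D} (h : ∀ f ∈ S, ∃ η > 0, ∀ g : D, WW η η f.1 g.1 → g ∈ S) :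
    IsOpen S := by
  rw [isOpen_iff_forall_mem_open]
  intro f hf
  obtain ⟨η, hη, hS⟩ := h f hf
  refine ⟨{g | dJ1 f g < η}, fun g hg => ?_, ball_open f hη, dJ1_self f hη⟩
  obtain ⟨a, b, hab, l, hl, h1, h2⟩ := dJ1_lt_iff.1 hg
  obtain ⟨ha, hb⟩ := WW_b_nonneg ⟨l, hl, h1, h2⟩
  exact hS g ⟨l, hl, fun t => (h1 t).trans (by linarith), fun t => (h2 t).trans (by linarith)⟩

def nrm (f : D) : ℝ := ⨆ t : unitI, |f.1 t|

lemma nrm_bdd (f : D) : BddAbove (Set.range fun t : unitI => |f.1 t|) := by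
  obtain ⟨M, hM⟩ := cadlag_bdd f.2
  exact ⟨M, by rintro _ ⟨t, rfl⟩; exact hM t⟩

lemma le_nrm (f : D) (t : unitI) : |f.1 t| ≤ nrm f := le_ciSup (nrm_bdd f) t

lemma nrm_le {f : D} {C : ℝ} (h : ∀ t, |f.1 t| ≤ C) : nrm f ≤ C :=
  Real.iSup_le h ((abs_nonneg _).trans (h i0))

lemma open_nrm (C : ℝ) : IsOpen {f : D | nrm f < C} := by
  apply open_of
  intro f hf
  have hf' : nrm f < C := hf
  refine ⟨(C - nrm f) / 2, by simp only [gt_iff_lt]; linarith, fun g hg => ?_⟩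
  have : nrm g ≤ nrm f + (C - nrm f) / 2 := nrm_le (WW_bdd hg (le_nrm f))
  show nrm g < C
  linarith

lemma PP_improve {δ ε : ℝ} {f : unitI → ℝ} (h : PP δ ε f) : ∃ δ' > δ, PP δ' ε f := by
  obtain ⟨v, t, ⟨p, q, r⟩, ho⟩ := h
  obtain ⟨δ', h1, h2⟩ := exists_lt_all r
  exact ⟨δ', h1, v, t, ⟨p, q, h2⟩, ho⟩

lemma open_omegaP {δ : ℝ} (hδ : δ < 1) (ε : ℝ) : IsOpen {f : D | omegaP δ f < ε} := by
  apply open_of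
  intro f hf
  obtain ⟨ε', hε', hP⟩ := (omegaP_lt_iff f hδ).1 hf
  obtain ⟨δ', hδ', hP'⟩ := PP_improve hP
  refine ⟨min ((ε - ε') / 4) ((δ' - δ) / 2), ?_, fun g hg => ?_⟩
  · apply lt_min <;> linarith
  · refine (omegaP_lt_iff g hδ).2 ⟨_, ?_, PP_mono (WW_PP hg hP') ?_ le_rfl⟩
    · have := min_le_left ((ε - ε') / 4) ((δ' - δ) / 2)
      linarith
    · have := min_le_right ((ε - ε') / 4) ((δ' - δ) / 2)
      linarith

lemma omegaP_anti {δ δ' : ℝ} (h : δ' ≤ δ) (hδ : δ < 1) (f : D) : omegaP δ' f ≤ omegaP δ f := by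
  apply le_of_forall_gt
  intro ε hε
  obtain ⟨e, he, hP⟩ := (omegaP_lt_iff f hδ).1 hε
  exact (omegaP_lt_iff f (h.trans_lt hδ)).2 ⟨e, he, PP_mono hP h le_rfl⟩

lemma Prt_lt {v : ℕ} {t : Fin (v + 1) → unitI} (h : Prt v t 0) (i : Fin v) :
    t i.castSucc < t i.succ := by
  have := h.2.2 i
  exact Subtype.coe_lt_coe.1 (by linarith)

lemma fin_tele {v : ℕ} (F : Fin (v + 1) → ℝ) :
    ∑ i : Fin v, (F i.succ - F i.castSucc) = F (Fin.last v) - F 0 := by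
  induction v with
  | zero => simp
  | succ n ih =>
    rw [Fin.sum_univ_castSucc]
    have := ih (fun i => F i.castSucc)
    simp only [Fin.castSucc_zero] at this
    simp only [Fin.succ_castSucc, Fin.succ_last] 
    rw [this]
    ring

lemma exists_lambda {v : ℕ} {t t' : Fin (v + 1) → unitI} (h : Prt v t 0) (h' : Prt v t' 0) :
    ∃ l, TimeChange l ∧ (∀ j, l (t j) = t' j) ∧ ∀ s, |(l s : ℝ) - (s : ℝ)| ≤
      ∑ i : Fin v, |((t' i.succ : ℝ) - (t' i.castSucc : ℝ)) -
        ((t i.succ : ℝ) - (t i.castSucc : ℝ))| := by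
  obtain ⟨p, q, r⟩ := h
  obtain ⟨p', q', r'⟩ := h'
  have mt : StrictMono t := Fin.strictMono_iff_lt_succ.2 fun i => by
    have : (0:ℝ) < (t i.succ : ℝ) - (t i.castSucc : ℝ) := r i
    exact Subtype.coe_lt_coe.1 (by linarith)
  have mt' : StrictMono t' := Fin.strictMono_iff_lt_succ.2 fun i => by
    have : (0:ℝ) < (t' i.succ : ℝ) - (t' i.castSucc : ℝ) := r' i
    exact Subtype.coe_lt_coe.1 (by linarith)
  set k : Fin v → ℝ := fun i => ((t' i.succ : ℝ) - (t' i.castSucc : ℝ)) /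
        ((t i.succ : ℝ) - (t i.castSucc : ℝ)) with hk
  have kpos : ∀ i, 0 < k i := fun i => div_pos (r' i) (r i)
  set G : Fin v → ℝ → ℝ := fun i s => min (t i.succ : ℝ) s - min (t i.castSucc : ℝ) s with hG
  have Gsum : ∀ s : unitI, ∑ i, G i s = s := by
    intro s
    have := fin_tele (fun i => min (t i : ℝ) (s : ℝ))
    simp only [hG]
    rw [this, p, q]
    have e1 : min ((i1 : unitI) : ℝ) s = s := min_eq_right (le_i1 s)
    have e2 : min ((i0 : unitI) : ℝ) s = 0 := min_eq_left (i0_le s)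
    rw [e1, e2, sub_zero]
  have Gmono : ∀ i, Monotone (G i) := by
    intro i a b hab
    have := r i
    simp only [hG]
    rcases min_cases (t i.succ : ℝ) a with h1 | h1 <;>
    rcases min_cases (t i.succ : ℝ) b with h2 | h2 <;>
    rcases min_cases (t i.castSucc : ℝ) a with h3 | h3 <;>
    rcases min_cases (t i.castSucc : ℝ) b with h4 | h4 <;> linarith
  have Gnn : ∀ i s, 0 ≤ G i s := by
    intro i s
    have := r i
    exact sub_nonneg.2 (min_le_min_right _ (by linarith))
  have Gle : ∀ i s, G i s ≤ (t i.succ : ℝ) - (t i.castSucc : ℝ) := by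
    intro i s
    have := r i
    simp only [hG]
    rcases min_cases (t i.succ : ℝ) s with h1 | h1 <;>
    rcases min_cases (t i.castSucc : ℝ) s with h3 | h3 <;> linarith
  set L : ℝ → ℝ := fun s => ∑ i, k i * G i s with hL
  have Lt : ∀ j, L (t j) = t' j := by
    intro j
    have e : ∀ i, k i * G i (t j) = min (t' i.succ : ℝ) (t' j) - min (t' i.castSucc : ℝ) (t' j) := by
      intro i
      have ri : (t i.succ : ℝ) - (t i.castSucc : ℝ) ≠ 0 := (r i).ne'
      rcases le_or_gt j i.castSucc with hji | hji
      · have hj2 : j ≤ i.succ := hji.trans (Fin.castSucc_lt_succ).le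
        have a1 : (t j : ℝ) ≤ t i.castSucc := mt.monotone hji
        have a2 : (t j : ℝ) ≤ t i.succ := mt.monotone hj2
        have a3 : (t' j : ℝ) ≤ t' i.castSucc := mt'.monotone hji
        have a4 : (t' j : ℝ) ≤ t' i.succ := mt'.monotone hj2
        simp only [hG]
        rw [min_eq_right a1, min_eq_right a2, min_eq_right a3, min_eq_right a4]
        simp
      · have hj2 : i.succ ≤ j := Fin.castSucc_lt_iff_succ_le.1 hji
        have a1 : (t i.castSucc : ℝ) ≤ t j := mt.monotone hji.le
        have a2 : (t i.succ : ℝ) ≤ t j := mt.monotone hj2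
        have a3 : (t' i.castSucc : ℝ) ≤ t' j := mt'.monotone hji.le
        have a4 : (t' i.succ : ℝ) ≤ t' j := mt'.monotone hj2
        simp only [hG, hk]
        rw [min_eq_left a1, min_eq_left a2, min_eq_left a3, min_eq_left a4]
        field_simp
    simp only [hL, e]
    rw [fin_tele (fun i => min (t' i : ℝ) (t' j : ℝ)), p', q']
    have e1 : min ((i1 : unitI) : ℝ) (t' j) = t' j := min_eq_right (le_i1 _)
    have e2 : min ((i0 : unitI) : ℝ) (t' j) = 0 := min_eq_left (i0_le _)
    rw [e1, e2, sub_zero]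
  have Lmono : Monotone L := by
    intro a b hab
    exact Finset.sum_le_sum fun i _ => mul_le_mul_of_nonneg_left (Gmono i hab) (kpos i).le
  have Lstrict : ∀ a b : unitI, a < b → L a < L b := by
    intro a b hab
    refine Finset.sum_lt_sum
      (fun i _ => mul_le_mul_of_nonneg_left (Gmono i (le_of_lt hab)) (kpos i).le) ?_
    by_contra hcon
    push Not at hcon
    have : (b : ℝ) ≤ a := by
      rw [← Gsum a, ← Gsum b]
      exact Finset.sum_le_sum fun i hi => le_of_mul_le_mul_left (hcon i hi) (kpos i)
    exact absurd hab (not_lt.2 this)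
  have L0 : L 0 = 0 := by have := Lt 0; rwa [p, p'] at this
  have L1 : L 1 = 1 := by have := Lt (Fin.last v); rwa [q, q'] at this
  have Lcont : Continuous L := by
    simp only [hL, hG]
    fun_prop
  have Lmem : ∀ s : unitI, L s ∈ Set.Icc (0:ℝ) 1 := fun s =>
    ⟨L0.symm.le.trans (Lmono s.2.1), (Lmono s.2.2).trans L1.le⟩
  have sm : StrictMono (fun s : unitI => (⟨L s, Lmem s⟩ : unitI)) := fun a b hab => Lstrict a b hab
  refine ⟨fun s => ⟨L s, Lmem s⟩, ⟨sm, sm.injective, ?_⟩, fun j => Subtype.ext (Lt j), ?_⟩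
  · intro y
    have := intermediate_value_Icc (zero_le_one) Lcont.continuousOn
    rw [L0, L1] at this
    obtain ⟨x, hx, hxy⟩ := this y.2
    exact ⟨⟨x, hx⟩, Subtype.ext hxy⟩
  · intro s
    have : L s - s = ∑ i, (k i - 1) * G i s := by
      nth_rewrite 2 [← Gsum s]
      simp only [hL]
      rw [← Finset.sum_sub_distrib]
      exact Finset.sum_congr rfl fun i _ => by ring
    show |L s - s| ≤ _
    rw [this]
    refine (Finset.abs_sum_le_sum_abs _ _).trans (Finset.sum_le_sum fun i _ => ?_)
    have ri : 0 < (t i.succ : ℝ) - (t i.castSucc : ℝ) := r i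
    have e : ((t' i.succ : ℝ) - (t' i.castSucc : ℝ)) - ((t i.succ : ℝ) - (t i.castSucc : ℝ)) =
        (k i - 1) * ((t i.succ : ℝ) - (t i.castSucc : ℝ)) := by
      simp only [hk]
      field_simp
    rw [e, abs_mul, abs_mul, abs_of_nonneg (Gnn i s), abs_of_pos ri]
    exact mul_le_mul_of_nonneg_left (Gle i s) (abs_nonneg _)

lemma cauchy_lim {l : Filter unitI} [l.NeBot] {f : unitI → ℝ}
    (h : ∀ ε > 0, ∃ S ∈ l, ∀ x ∈ S, ∀ y ∈ S, |f x - f y| ≤ ε) : ∃ L, Tendsto f l (𝓝 L) := by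
  rw [← cauchy_map_iff_exists_tendsto, Metric.cauchy_iff]
  refine ⟨inferInstance, fun ε hε => ?_⟩
  obtain ⟨S, hS, hx⟩ := h (ε / 2) (half_pos hε)
  refine ⟨f '' S, image_mem_map hS, ?_⟩
  rintro _ ⟨x, hxS, rfl⟩ _ ⟨y, hyS, rfl⟩
  rw [Real.dist_eq]
  exact (hx x hxS y hyS).trans_lt (half_lt_self hε)

lemma cadlag_of {g : unitI → ℝ} (h : ∀ ε > 0, PP 0 ε g) : Cadlag g := by
  constructor
  · intro s
    rcases (le_i1 s).eq_or_lt with hs | hs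
    · have : 𝓝[>] s = ⊥ := by
        have : Set.Ioi s = ∅ := by
          ext x
          simp only [Set.mem_Ioi, Set.mem_empty_iff_false, iff_false, not_lt]
          rw [hs]; exact le_i1 x
        rw [this, nhdsWithin_empty]
      rw [this]; exact tendsto_bot
    rw [Metric.tendsto_nhds]
    intro ε hε
    obtain ⟨v, t, ⟨p, q, r⟩, ho⟩ := h (ε / 2) (half_pos hε)
    obtain ⟨i, h1, h2⟩ := Prt_loc p q hs
    filter_upwards [Ioo_mem_nhdsGT h2] with u hu
    rw [Real.dist_eq]
    exact (ho i s u h1 h2 (h1.trans hu.1.le) hu.2).trans_lt (half_lt_self hε)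
  · intro s
    rcases (i0_le s).eq_or_lt with hs | hs
    · have : 𝓝[<] s = ⊥ := by
        have : Set.Iio s = ∅ := by
          ext x
          simp only [Set.mem_Iio, Set.mem_empty_iff_false, iff_false, not_lt]
          rw [← hs]; exact i0_le x
        rw [this, nhdsWithin_empty]
      rw [this]; exact ⟨0, tendsto_bot⟩
    have : (𝓝[<] s).NeBot := nhdsLT_neBot_of_exists_lt ⟨_, hs⟩
    apply cauchy_lim
    intro ε hε
    obtain ⟨v, t, ⟨p, q, r⟩, ho⟩ := h ε hε
    obtain ⟨i, h1, h2⟩ := Prt_loc' p q hs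
    exact ⟨_, Ioo_mem_nhdsLT h1, fun x hx y hy =>
      ho i y x hy.1.le (hy.2.trans_le h2) hx.1.le (hx.2.trans_le h2)⟩

lemma ultra_exists {α : Type*} (U : Ultrafilter α) (N : ℕ) {Q : ℕ → α → Prop}
    (h : ∀ᶠ f in (U : Filter α), ∃ v < N, Q v f) : ∃ v, ∀ᶠ f in (U : Filter α), Q v f := by
  induction N with
  | zero =>
    obtain ⟨f, v, hv, -⟩ := h.exists
    exact absurd hv (Nat.not_lt_zero v)
  | succ n ih =>
    have : ∀ᶠ f in (U : Filter α), (∃ v < n, Q v f) ∨ Q n f := by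
      filter_upwards [h] with f hf
      obtain ⟨v, hv, hq⟩ := hf
      rcases (Nat.lt_succ_iff.1 hv).eq_or_lt with e | e
      · right; rwa [← e]
      · left; exact ⟨v, e, hq⟩
    rcases Ultrafilter.eventually_or.1 this with h | h
    · exact ih h
    · exact ⟨n, h⟩

lemma Prt_card {v : ℕ} {t : Fin (v + 1) → unitI} {δ : ℝ} (h : Prt v t δ) : v * δ ≤ 1 := by
  obtain ⟨p, q, r⟩ := h
  have h1 := fin_tele (fun i => (t i : ℝ))
  rw [p, q] at h1
  have h2 : ∑ i : Fin v, δ ≤ ∑ i : Fin v, ((t i.succ : ℝ) - (t i.castSucc : ℝ)) :=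
    Finset.sum_le_sum fun i _ => (r i).le
  rw [h1] at h2
  simpa [i0, i1] using h2

lemma ultra_part (U : Ultrafilter D) {δ ε : ℝ} (hδ : 0 < δ)
    (h : ∀ᶠ f : D in (U : Filter D), PP δ ε f.1) :
    ∃ (v : ℕ) (τ : D → Fin (v + 1) → unitI) (t : Fin (v + 1) → unitI), Prt v t 0 ∧
      Tendsto τ U (𝓝 t) ∧ ∀ᶠ f : D in (U : Filter D), Prt v (τ f) 0 ∧ Osc v (τ f) f.1 ε := by
  obtain ⟨N, hN⟩ := exists_nat_gt (1 / δ)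
  have : ∀ᶠ f : D in (U : Filter D), ∃ v < N, ∃ t : Fin (v + 1) → unitI,
      Prt v t δ ∧ Osc v t f.1 ε := by
    filter_upwards [h] with f hf
    obtain ⟨v, t, hp, ho⟩ := hf
    refine ⟨v, ?_, t, hp, ho⟩
    have h1 := Prt_card hp
    have h2 : (v : ℝ) ≤ 1 / δ := by rwa [le_div_iff₀ hδ]
    exact_mod_cast h2.trans_lt hN
  obtain ⟨v, hv⟩ := ultra_exists U N this
  classical
  set τ : D → Fin (v + 1) → unitI := fun f =>
    if h : ∃ t : Fin (v + 1) → unitI, Prt v t δ ∧ Osc v t f.1 ε then h.choose else fun _ => i0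
  have hτ : ∀ᶠ f : D in (U : Filter D), Prt v (τ f) δ ∧ Osc v (τ f) f.1 ε := by
    filter_upwards [hv] with f hf
    simp only [τ, dif_pos hf]
    exact hf.choose_spec
  obtain ⟨t, -, ht⟩ := isCompact_iff_ultrafilter_le_nhds.1
    (isCompact_univ (X := Fin (v + 1) → unitI)) (U.map τ) (by simp)
  have ht' : Tendsto τ U (𝓝 t) := ht
  have hti : ∀ i, Tendsto (fun f => τ f i) U (𝓝 (t i)) := fun i => tendsto_pi_nhds.1 ht' i
  have htr : ∀ i, Tendsto (fun f => (τ f i : ℝ)) U (𝓝 (t i : ℝ)) := fun i =>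
    (continuous_subtype_val.tendsto _).comp (hti i)
  refine ⟨v, τ, t, ⟨?_, ?_, fun i => ?_⟩, ht', ?_⟩
  · refine tendsto_nhds_unique (hti 0) (tendsto_const_nhds.congr' ?_)
    filter_upwards [hτ] with f hf using hf.1.1.symm
  · refine tendsto_nhds_unique (hti (Fin.last v)) (tendsto_const_nhds.congr' ?_)
    filter_upwards [hτ] with f hf using hf.1.2.1.symm
  · refine lt_of_lt_of_le hδ (ge_of_tendsto ((htr i.succ).sub (htr i.castSucc)) ?_)
    filter_upwards [hτ] with f hf using (hf.1.2.2 i).le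
  · filter_upwards [hτ] with f hf
    exact ⟨⟨hf.1.1, hf.1.2.1, fun i => hδ.trans (hf.1.2.2 i)⟩, hf.2⟩

lemma ultra_lim (U : Ultrafilter D) (C : ℝ)
    (hC : ∀ᶠ f : D in (U : Filter D), ∀ s, |f.1 s| ≤ C)
    (hP : ∀ ε > 0, ∃ δ > 0, ∀ᶠ f : D in (U : Filter D), PP δ ε f.1) :
    ∃ g : D, ∀ ε > 0, ∀ᶠ f : D in (U : Filter D), WW ε ε f.1 g.1 := by
  have hφ : ∀ s : unitI, ∃ y : ℝ, Tendsto (fun f : D => f.1 s) U (𝓝 y) := by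
    intro s
    obtain ⟨y, -, hy⟩ := isCompact_iff_ultrafilter_le_nhds.1
      (isCompact_Icc (a := -C) (b := C)) (U.map (fun f : D => f.1 s)) (by
        rw [le_principal_iff]
        show ∀ᶠ f : D in (U : Filter D), f.1 s ∈ Set.Icc (-C) C
        filter_upwards [hC] with f hf using abs_le.1 (hf s))
    exact ⟨y, hy⟩
  choose φ hφ using hφ
  -- limit partitions
  have hpart : ∀ ε > 0, ∃ (v : ℕ) (τ : D → Fin (v + 1) → unitI) (t : Fin (v + 1) → unitI),
      Prt v t 0 ∧ Tendsto τ U (𝓝 t) ∧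
      ∀ᶠ f : D in (U : Filter D), Prt v (τ f) 0 ∧ Osc v (τ f) f.1 ε := by
    intro ε hε
    obtain ⟨δ, hδ, h⟩ := hP ε hε
    exact ultra_part U hδ h
  have hin : ∀ {v : ℕ} {τ : D → Fin (v + 1) → unitI} {t : Fin (v + 1) → unitI},
      Tendsto τ U (𝓝 t) → ∀ (i : Fin v) (r : unitI), t i.castSucc < r → r < t i.succ →
      ∀ᶠ f : D in (U : Filter D), τ f i.castSucc < r ∧ r < τ f i.succ := by
    intro v τ t ht i r h1 h2
    exact ((tendsto_pi_nhds.1 ht _).eventually_lt_const h1).and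
      ((tendsto_pi_nhds.1 ht _).eventually_const_lt h2)
  have hosc : ∀ {v : ℕ} {τ : D → Fin (v + 1) → unitI} {t : Fin (v + 1) → unitI} {ε : ℝ},
      Tendsto τ U (𝓝 t) → (∀ᶠ f : D in (U : Filter D), Prt v (τ f) 0 ∧ Osc v (τ f) f.1 ε) →
      ∀ (i : Fin v) (r r' : unitI), t i.castSucc < r → r < t i.succ →
        t i.castSucc < r' → r' < t i.succ → |φ r - φ r'| ≤ ε := by
    intro v τ t ε ht hp i r r' h1 h2 h3 h4
    refine le_of_tendsto ((hφ r).sub (hφ r')).abs ?_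
    filter_upwards [hp, hin ht i r h1 h2, hin ht i r' h3 h4] with f hf hr hr'
    exact hf.2 i r' r hr'.1.le hr'.2 hr.1.le hr.2
  have hg : ∀ s : unitI, ∃ y : ℝ, (s < i1 → Tendsto φ (𝓝[>] s) (𝓝 y)) ∧ (s = i1 → y = φ i1) := by
    intro s
    rcases (le_i1 s).eq_or_lt with hs | hs
    · exact ⟨φ i1, fun h => absurd hs h.ne, fun _ => rfl⟩
    · have : (𝓝[>] s).NeBot := nhdsGT_neBot_of_exists_gt ⟨_, hs⟩
      obtain ⟨y, hy⟩ : ∃ y, Tendsto φ (𝓝[>] s) (𝓝 y) := by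
        apply cauchy_lim
        intro ε hε
        obtain ⟨v, τ, t, hp, ht, hq⟩ := hpart ε hε
        obtain ⟨i, h1, h2⟩ := Prt_loc hp.1 hp.2.1 hs
        exact ⟨_, Ioo_mem_nhdsGT h2, fun x hx y hy => hosc ht hq i x y (h1.trans_lt hx.1) hx.2
          (h1.trans_lt hy.1) hy.2⟩
      exact ⟨y, fun _ => hy, fun h => absurd h hs.ne⟩
  choose g hg1 hg2 using hg
  have hgφ : ∀ {v : ℕ} {τ : D → Fin (v + 1) → unitI} {t : Fin (v + 1) → unitI} {ε : ℝ},
      Tendsto τ U (𝓝 t) → (∀ᶠ f : D in (U : Filter D), Prt v (τ f) 0 ∧ Osc v (τ f) f.1 ε) →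
      ∀ (i : Fin v) (s r : unitI), t i.castSucc ≤ s → s < t i.succ →
        t i.castSucc < r → r < t i.succ → |g s - φ r| ≤ ε := by
    intro v τ t ε ht hp i s r h1 h2 h3 h4
    have hs : s < i1 := h2.trans_le (le_i1 _)
    have : (𝓝[>] s).NeBot := nhdsGT_neBot_of_exists_gt ⟨_, hs⟩
    refine le_of_tendsto ((hg1 s hs).sub_const (φ r)).abs ?_
    filter_upwards [Ioo_mem_nhdsGT h2] with x hx
    exact hosc ht hp i x r (h1.trans_lt hx.1) hx.2 h3 h4
  have hcad : Cadlag g := by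
    apply cadlag_of
    intro ε hε
    obtain ⟨v, τ, t, hp, ht, hq⟩ := hpart (ε / 2) (half_pos hε)
    refine ⟨v, t, hp, ?_⟩
    intro i s u h1 h2 h3 h4
    obtain ⟨r, hr1, hr2⟩ := exists_between (Prt_lt hp i)
    have e1 := hgφ ht hq i s r h1 h2 hr1 hr2
    have e2 := hgφ ht hq i u r h3 h4 hr1 hr2
    rw [abs_le] at *
    constructor <;> linarith
  refine ⟨⟨g, hcad⟩, fun ε hε => ?_⟩
  obtain ⟨v, τ, t, hp, ht, hq⟩ := hpart (ε / 3) (by linarith)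
  have hmid : ∀ i : Fin v, ∃ r, t i.castSucc < r ∧ r < t i.succ := fun i =>
    exists_between (Prt_lt hp i)
  choose r hr1 hr2 using hmid
  have hti : ∀ i, Tendsto (fun f => (τ f i : ℝ)) U (𝓝 (t i : ℝ)) := fun i =>
    (continuous_subtype_val.tendsto _).comp (tendsto_pi_nhds.1 ht i)
  have hsum : Tendsto (fun f => ∑ i : Fin v, |((τ f i.succ : ℝ) - (τ f i.castSucc : ℝ)) -
        ((t i.succ : ℝ) - (t i.castSucc : ℝ))|) U (𝓝 0) := by
    have := tendsto_finsetSum (Finset.univ : Finset (Fin v)) (fun i _ =>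
      ((((hti i.succ).sub (hti i.castSucc)).sub_const
        ((t i.succ : ℝ) - (t i.castSucc : ℝ))).abs))
    simpa using this
  have hval : ∀ x : unitI, ∀ᶠ f : D in (U : Filter D), |f.1 x - φ x| ≤ ε / 3 := by
    intro x
    have := (hφ x).eventually (Metric.closedBall_mem_nhds (φ x) (show 0 < ε / 3 by linarith))
    filter_upwards [this] with f hf
    simpa [Real.dist_eq] using hf
  have hall : ∀ᶠ f : D in (U : Filter D), ∀ i : Fin v, |f.1 (r i) - φ (r i)| ≤ ε / 3 ∧
      τ f i.castSucc < r i ∧ r i < τ f i.succ :=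
    eventually_all.2 fun i => (hval (r i)).and (hin ht i (r i) (hr1 i) (hr2 i))
  filter_upwards [hq, hsum.eventually_le_const hε, hval i1, hall] with f hf hs h1 hr
  obtain ⟨l, hl, hlt, hls⟩ := exists_lambda hp hf.1
  refine ⟨l, hl, fun s => ?_, fun s => (hls s).trans hs⟩
  show |f.1 (l s) - g s| ≤ ε
  rcases (le_i1 s).eq_or_lt with hs1 | hs1
  · have e : l i1 = i1 := by rw [← hp.2.1, hlt, hf.1.2.1, hp.2.1]
    rw [hg2 s hs1, hs1, e]
    linarith
  · obtain ⟨i, k1, k2⟩ := Prt_loc hp.1 hp.2.1 hs1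
    have e1 := hgφ ht hq i s (r i) k1 k2 (hr1 i) (hr2 i)
    have e2 := (hr i).1
    have m1 : τ f i.castSucc ≤ l s := by rw [← hlt]; exact hl.1.monotone k1
    have m2 : l s < τ f i.succ := by rw [← hlt]; exact hl.1 k2
    have e3 := hf.2 i (r i) (l s) (hr i).2.1.le (hr i).2.2 m1 m2
    rw [abs_le] at *
    constructor <;> linarith

lemma compact_closure_of {A : Set D} (C : ℝ) (hC : ∀ f ∈ A, ∀ s, |f.1 s| ≤ C)
    (hP : ∀ ε > 0, ∃ δ > 0, ∀ f ∈ A, PP δ ε f.1) : IsCompact (closure A) := by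
  have happ : ∀ g ∈ closure A, ∀ η > 0, ∃ f ∈ A, WW η η f.1 g.1 := by
    intro g hg η hη
    obtain ⟨f, hf, hfA⟩ := mem_closure_iff.1 hg _ (ball_open g hη) (dJ1_self g hη)
    obtain ⟨a, b, hab, hW⟩ := dJ1_lt_iff.1 hf
    obtain ⟨ha, hb⟩ := WW_b_nonneg hW
    obtain ⟨l, hl, h1, h2⟩ := WW_symm hW
    exact ⟨f, hfA, l, hl, fun t => (h1 t).trans (by linarith), fun t => (h2 t).trans (by linarith)⟩
  rw [isCompact_iff_ultrafilter_le_nhds]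
  intro U hU
  have hU' : ∀ᶠ f in (U : Filter D), f ∈ closure A := le_principal_iff.1 hU
  obtain ⟨g, hg⟩ := ultra_lim U (C + 1) (by
      filter_upwards [hU'] with g hg
      obtain ⟨f, hf, hW⟩ := happ g hg 1 one_pos
      exact WW_bdd hW (hC f hf)) (by
      intro ε hε
      obtain ⟨δ, hδ, h⟩ := hP (ε / 2) (half_pos hε)
      refine ⟨δ / 2, half_pos hδ, ?_⟩
      filter_upwards [hU'] with g hg
      obtain ⟨f, hf, hW⟩ := happ g hg (min (δ / 4) (ε / 4)) (by apply lt_min <;> linarith)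
      have m1 := min_le_left (δ / 4) (ε / 4)
      have m2 := min_le_right (δ / 4) (ε / 4)
      exact PP_mono (WW_PP hW (h f hf)) (by linarith) (by linarith))
  have hle : (U : Filter D) ≤ 𝓝 g := by
    rw [TopologicalSpace.nhds_generateFrom]
    refine le_iInf₂ fun s hs => ?_
    obtain ⟨hgs, h, η, hη, rfl⟩ := hs
    rw [le_principal_iff]
    obtain ⟨a, b, hab, hW⟩ := dJ1_lt_iff.1 hgs
    filter_upwards [hg ((η - (a + b)) / 4) (by linarith)] with f hf
    exact dJ1_lt_iff.2 ⟨_, _, by linarith, WW_trans hW (WW_symm hf)⟩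
  exact ⟨g, isClosed_iff_ultrafilter.1 isClosed_closure g U hle hU', hle⟩

lemma unif_small {Ω : Type*} [MeasurableSpace Ω] (P : Measure Ω) [IsProbabilityMeasure P]
    {A : ℕ → ℕ → Set Ω} (hm : ∀ n m, MeasurableSet (A n m)) (ha : ∀ n, Antitone (A n))
    (hi : ∀ n, ⋂ m, A n m = ∅) {η : ENNReal} (hη : 0 < η)
    (h : ∃ m, Filter.limsup (fun n => P (A n m)) atTop < η) : ∃ m, ∀ n, P (A n m) < η := by
  obtain ⟨m0, hm0⟩ := h
  obtain ⟨N, hN⟩ := eventually_atTop.1 (eventually_lt_of_limsup_lt hm0)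
  have h1 : ∀ n, ∀ᶠ m in atTop, P (A n m) < η := by
    intro n
    have := tendsto_measure_iInter_atTop (μ := P) (fun m => (hm n m).nullMeasurableSet) (ha n)
      ⟨0, measure_ne_top _ _⟩
    rw [hi n, measure_empty] at this
    exact this.eventually_lt_const hη
  have h2 : ∀ᶠ m in atTop, ∀ n ∈ Finset.range N, P (A n m) < η :=
    (eventually_all_finset (Finset.range N)).2 fun n _ => h1 n
  obtain ⟨m, hmN, hmm⟩ := (h2.and (eventually_ge_atTop m0)).exists
  refine ⟨m, fun n => ?_⟩
  rcases lt_or_ge n N with hn | hn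
  · exact hmN n (Finset.mem_range.2 hn)
  · exact (measure_mono (ha n hmm)).trans_lt (hN n hn)

def dl (m : ℕ) : ℝ := 1 / ((m : ℝ) + 2)

lemma dl_pos (m : ℕ) : 0 < dl m := by unfold dl; positivity

lemma dl_lt (m : ℕ) : dl m < 1 := by
  unfold dl
  rw [div_lt_one (by positivity)]
  have : (0:ℝ) ≤ m := Nat.cast_nonneg m
  linarith

lemma dl_anti : Antitone dl := by
  intro a b hab
  unfold dl
  have : (a:ℝ) ≤ b := Nat.cast_le.2 hab
  gcongr

lemma dl_tendsto : Tendsto dl atTop (𝓝[>] 0) := by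
  rw [tendsto_nhdsWithin_iff]
  refine ⟨?_, Eventually.of_forall dl_pos⟩
  have := (tendsto_one_div_add_atTop_nhds_zero_nat (𝕜 := ℝ)).comp (tendsto_add_atTop_nat 1)
  refine this.congr fun m => ?_
  simp only [Function.comp, dl]
  push_cast
  ring_nf

lemma omegaP_small (f : D) {ε : ℝ} (hε : 0 < ε) : ∃ m, omegaP (dl m) f < ε := by
  obtain ⟨δ, hδ, hP⟩ := PP_of_cadlag f.2 (half_pos hε)
  obtain ⟨m, hm⟩ := (dl_tendsto.eventually (Ioo_mem_nhdsGT hδ)).exists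
  exact ⟨m, (omegaP_lt_iff f (dl_lt m)).2 ⟨_, half_lt_self hε, PP_mono hP hm.2.le le_rfl⟩⟩

lemma compact_nrm {K : Set D} (hK : IsCompact K) : ∃ C, ∀ f ∈ K, nrm f < C := by
  obtain ⟨n, hn⟩ := hK.elim_directed_cover (fun n : ℕ => {f : D | nrm f < n})
    (fun n => open_nrm n) (fun f _ => by
      obtain ⟨n, hn⟩ := exists_nat_gt (nrm f)
      exact mem_iUnion.2 ⟨n, hn⟩)
    (Monotone.directed_le fun a b hab f hf => by
      have h1 : nrm f < (a : ℝ) := hf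
      have h2 : (a : ℝ) ≤ b := Nat.cast_le.2 hab
      exact h1.trans_le h2)
  exact ⟨n, fun f hf => hn hf⟩

lemma compact_omegaP {K : Set D} (hK : IsCompact K) {ε : ℝ} (hε : 0 < ε) :
    ∃ m, ∀ f ∈ K, omegaP (dl m) f < ε := by
  obtain ⟨n, hn⟩ := hK.elim_directed_cover (fun n : ℕ => {f : D | omegaP (dl n) f < ε})
    (fun n => open_omegaP (dl_lt n) ε) (fun f _ => mem_iUnion.2 (omegaP_small f hε))
    (Monotone.directed_le fun a b hab f hf =>
      lt_of_le_of_lt (omegaP_anti (dl_anti hab) (dl_lt a) f) hf)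
  exact ⟨n, fun f hf => hn hf⟩

instance : BorelSpace D := ⟨rfl⟩

/-- A sequence `(X_n)` of random elements of `(D, d_{J1})` (with its
Borel σ-algebra) is tight iff (i) `lim_{C → ∞} limsup_n P(‖X_n‖_∞ ≥ C) = 0` and
(ii) for every `ε > 0`, `lim_{δ ↓ 0} limsup_n P(ω'_δ(X_n) ≥ ε) = 0`. -/
theorem tight_in_J1_iff {Ω : Type*} [MeasurableSpace Ω]
    (P : Measure Ω) [IsProbabilityMeasure P]
    (X : ℕ → Ω → D) (hX : ∀ n, Measurable (X n)) :
    (∀ ε : ENNReal, 0 < ε → ∃ K : Set D, IsCompact K ∧ ∀ n, P {ω | X n ω ∉ K} < ε) ↔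
      (Tendsto (fun C : ℝ =>
          Filter.limsup (fun n => P {ω | C ≤ ⨆ t : unitI, |(X n ω).1 t|}) atTop)
          atTop (𝓝 0) ∧
        ∀ ε : ℝ, 0 < ε →
          Tendsto (fun δ : ℝ =>
              Filter.limsup (fun n => P {ω | ε ≤ omegaP δ (X n ω)}) atTop)
            (𝓝[>] (0:ℝ)) (𝓝 0)) := by
  constructor
  · intro h
    constructor
    · rw [ENNReal.tendsto_nhds_zero]
      intro ε hε
      obtain ⟨K, hK, hP⟩ := h ε hε
      obtain ⟨C, hC⟩ := compact_nrm hK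
      filter_upwards [eventually_ge_atTop C] with c hc
      refine limsup_le_of_le (h := Eventually.of_forall fun n => ?_)
      refine (measure_mono fun ω hω hk => ?_).trans (hP n).le
      exact absurd (hC _ hk) (not_lt.2 (hc.trans hω))
    · intro e he
      rw [ENNReal.tendsto_nhds_zero]
      intro ε hε
      obtain ⟨K, hK, hP⟩ := h ε hε
      obtain ⟨m, hm⟩ := compact_omegaP hK he
      filter_upwards [Ioo_mem_nhdsGT (dl_pos m)] with c hc
      refine limsup_le_of_le (h := Eventually.of_forall fun n => ?_)
      refine (measure_mono fun ω hω hk => ?_).trans (hP n).le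
      exact absurd (hm _ hk) (not_lt.2 (le_trans hω (omegaP_anti hc.2.le (dl_lt m) _)))
  · rintro ⟨h1, h2⟩ ε hε
    have hε2 : 0 < ε / 2 := ENNReal.half_pos hε.ne'
    obtain ⟨e, he, hes⟩ := ENNReal.exists_pos_sum_of_countable' hε2.ne' ℕ
    obtain ⟨c, hc⟩ : ∃ c : ℕ, ∀ n, P {ω | (c : ℝ) ≤ nrm (X n ω)} < ε / 2 := by
      refine unif_small P (A := fun n c => {ω | (c : ℝ) ≤ nrm (X n ω)}) ?_ ?_ ?_ hε2 ?_
      · intro n m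
        have := (hX n (open_nrm m).measurableSet).compl
        convert this using 1
        ext ω
        simp
      · intro n a b hab ω hω
        have h1 : (b : ℝ) ≤ nrm (X n ω) := hω
        have h2 : (a : ℝ) ≤ b := Nat.cast_le.2 hab
        exact h2.trans h1
      · intro n
        ext ω
        simp only [mem_iInter, mem_ofPred_eq, mem_empty_iff_false, iff_false, not_forall, not_le]
        exact exists_nat_gt _
      · exact ((h1.comp tendsto_natCast_atTop_atTop).eventually_lt_const hε2).exists
    have hd : ∀ k : ℕ, ∃ m : ℕ, ∀ n, P {ω | 1 / ((k : ℝ) + 1) ≤ omegaP (dl m) (X n ω)} < e k := by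
      intro k
      have hk : (0:ℝ) < 1 / ((k : ℝ) + 1) := by positivity
      refine unif_small P (A := fun n m => {ω | 1 / ((k : ℝ) + 1) ≤ omegaP (dl m) (X n ω)})
        ?_ ?_ ?_ (he k) ?_
      · intro n m
        have := (hX n (open_omegaP (dl_lt m) (1 / ((k : ℝ) + 1))).measurableSet).compl
        convert this using 1
        ext ω
        simp
      · intro n a b hab ω hω
        exact le_trans hω (omegaP_anti (dl_anti hab) (dl_lt a) _)
      · intro n
        ext ω
        simp only [mem_iInter, mem_ofPred_eq, mem_empty_iff_false, iff_false, not_forall, not_le]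
        exact omegaP_small _ hk
      · exact (((h2 _ hk).comp dl_tendsto).eventually_lt_const (he k)).exists
    choose m hm using hd
    set A : Set D := {f | nrm f < c ∧ ∀ k : ℕ, omegaP (dl (m k)) f < 1 / ((k : ℝ) + 1)} with hA
    refine ⟨closure A, compact_closure_of c (fun f hf s => (le_nrm f s).trans hf.1.le) ?_, ?_⟩
    · intro x hx
      obtain ⟨k, hk⟩ := exists_nat_one_div_lt hx
      refine ⟨dl (m k), dl_pos _, fun f hf => ?_⟩
      obtain ⟨x', hx', hp⟩ := (omegaP_lt_iff f (dl_lt _)).1 (hf.2 k)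
      exact PP_mono hp le_rfl (hx'.trans hk).le
    · intro n
      have hsub : {ω | X n ω ∉ closure A} ⊆ {ω | (c : ℝ) ≤ nrm (X n ω)} ∪
          ⋃ k : ℕ, {ω | 1 / ((k : ℝ) + 1) ≤ omegaP (dl (m k)) (X n ω)} := by
        intro ω hω
        by_contra hcon
        simp only [mem_union, mem_iUnion, mem_ofPred_eq, not_or, not_exists, not_le] at hcon
        exact hω (subset_closure hcon)
      calc P {ω | X n ω ∉ closure A} ≤ _ := measure_mono hsub
        _ ≤ _ := measure_union_le _ _
        _ ≤ P {ω | (c : ℝ) ≤ nrm (X n ω)} + ∑' k, e k := by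
          gcongr
          exact (measure_iUnion_le _).trans (ENNReal.tsum_le_tsum fun k => (hm k n).le)
        _ < ε / 2 + ε / 2 := ENNReal.add_lt_add (hc n) hes
        _ = ε := ENNReal.add_halves ε
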